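/- arXiv:2001.00080 — 5 statements merged into one kernel-verified Lean document; each statement's English description precedes it below -/
import Mathlib

section
/- Safety via a strict barrier certificate (convex condition): Let f : ℝⁿ × ℝᵐ → ℝⁿ be continuous, let X ⊆ ℝⁿ, X_I ⊆ X, X_U ⊆ X and D ⊆ ℝᵐ be given, and suppose there exists a differentiable function B : ℝⁿ → ℝ such that B(x) ≤ 0 for all x ∈ X_I, B(x) > 0 for all x ∈ X_U, and ⟪∇B(x), f(x,d)⟫ < 0 for all (x,d) ∈ X × D. Then for every T ≥ 0, every piecewise-continuous bounded disturbance d : [0,T] → D, and every solution x : [0,T] → ℝⁿ of ẋ(t) = f(x(t), d(t)) with x(0) ∈ X_I and x(t) ∈ X for all t ∈ [0,T], one has x(t) ∉ X_U for all t ∈ [0,T]. -/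
/-- **Safety via a strict barrier certificate (convex condition).**
If `B ≤ 0` on the initial set, `B > 0` on the unsafe set, and the Lie derivative
of `B` along the vector field is strictly negative everywhere on `X × D`, then
no solution starting in `X_I` (staying in `X`, with a piecewise-continuous bounded
disturbance valued in `D`) ever reaches `X_U`. -/
theorem safety_via_strict_barrier_certificate {n m : ℕ}
    (f : EuclideanSpace ℝ (Fin n) → EuclideanSpace ℝ (Fin m) → EuclideanSpace ℝ (Fin n))
    (hf : Continuous fun p : EuclideanSpace ℝ (Fin n) × EuclideanSpace ℝ (Fin m) => f p.1 p.2)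
    (X XI XU : Set (EuclideanSpace ℝ (Fin n))) (D : Set (EuclideanSpace ℝ (Fin m)))
    (hXI : XI ⊆ X) (hXU : XU ⊆ X)
    (B : EuclideanSpace ℝ (Fin n) → ℝ) (hB : Differentiable ℝ B)
    (hBI : ∀ x ∈ XI, B x ≤ 0)
    (hBU : ∀ x ∈ XU, 0 < B x)
    (hdec : ∀ x ∈ X, ∀ d ∈ D, fderiv ℝ B x (f x d) < 0) :
    ∀ T : ℝ, 0 ≤ T →
      ∀ (d : ℝ → EuclideanSpace ℝ (Fin m)) (x : ℝ → EuclideanSpace ℝ (Fin n)),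
        -- `d` is piecewise continuous on `[0, T]`
        (∃ S : Set ℝ, S.Finite ∧ ContinuousOn d (Set.Icc 0 T \ S)) →
        -- `d` is bounded on `[0, T]`
        Bornology.IsBounded (d '' Set.Icc 0 T) →
        -- `d` takes values in `D`
        (∀ t ∈ Set.Icc 0 T, d t ∈ D) →
        -- `x` is a solution of `ẋ(t) = f(x(t), d(t))` on `[0, T]`
        (∀ t ∈ Set.Icc 0 T, HasDerivAt x (f (x t) (d t)) t) →
        x 0 ∈ XI →
        (∀ t ∈ Set.Icc 0 T, x t ∈ X) →
        ∀ t ∈ Set.Icc 0 T, x t ∉ XU := by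
  intro T hT d x _ _ hdD hx hx0 hxX t ht htU
  have hderiv : ∀ s ∈ Set.Icc 0 T,
      HasDerivAt (B ∘ x) (fderiv ℝ B (x s) (f (x s) (d s))) s := fun s hs =>
    (hB (x s)).hasFDerivAt.comp_hasDerivAt s (hx s hs)
  have hanti : AntitoneOn (B ∘ x) (Set.Icc 0 T) := by
    refine antitoneOn_of_deriv_nonpos (convex_Icc 0 T)
      (fun s hs => (hderiv s hs).continuousAt.continuousWithinAt)
      (fun s hs => (hderiv s (interior_subset hs)).differentiableAt.differentiableWithinAt)
      fun s hs => ?_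
    have hs' := interior_subset hs
    rw [(hderiv s hs').deriv]
    exact (hdec _ (hxX s hs') _ (hdD s hs')).le
  have hle : B (x t) ≤ B (x 0) := hanti (Set.left_mem_Icc.2 hT) ht ht.1
  exact absurd (hBU _ htU) (hle.trans (hBI _ hx0)).not_gt
end

section
/- Safety via a barrier certificate with decrease only on the zero level set (non-convex condition): Let f : ℝⁿ × ℝᵐ → ℝⁿ be continuous, let X ⊆ ℝⁿ, X_I ⊆ X, X_U ⊆ X and D ⊆ ℝᵐ be given, and suppose there exists a continuously differentiable function B : ℝⁿ → ℝ such that B(x) ≤ 0 for all x ∈ X_I, B(x) > 0 for all x ∈ X_U, and ⟪∇B(x), f(x,d)⟫ < 0 for all (x,d) ∈ X × D with B(x) = 0. Then for every T ≥ 0, every continuous disturbance d : [0,T] → D, and every solution x : [0,T] → ℝⁿ of ẋ(t) = f(x(t), d(t)) with x(0) ∈ X_I and x(t) ∈ X for all t ∈ [0,T], one has x(t) ∉ X_U for all t ∈ [0,T]. -/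
/-- **Safety via a barrier certificate with decrease only on the zero level set
(non-convex condition).**
If `B ≤ 0` on the initial set, `B > 0` on the unsafe set, and the Lie derivative
of `B` along the vector field is strictly negative on `X × D` whenever `B x = 0`,
then no solution starting in `X_I` (staying in `X`, with a continuous disturbance
valued in `D`) ever reaches `X_U`. -/
theorem safety_via_zero_level_set_barrier_certificate {n m : ℕ}
    (f : EuclideanSpace ℝ (Fin n) → EuclideanSpace ℝ (Fin m) → EuclideanSpace ℝ (Fin n))
    (hf : Continuous fun p : EuclideanSpace ℝ (Fin n) × EuclideanSpace ℝ (Fin m) => f p.1 p.2)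
    (X XI XU : Set (EuclideanSpace ℝ (Fin n))) (D : Set (EuclideanSpace ℝ (Fin m)))
    (hXI : XI ⊆ X) (hXU : XU ⊆ X)
    (B : EuclideanSpace ℝ (Fin n) → ℝ) (hB : ContDiff ℝ 1 B)
    (hBI : ∀ x ∈ XI, B x ≤ 0)
    (hBU : ∀ x ∈ XU, 0 < B x)
    (hdec : ∀ x ∈ X, ∀ d ∈ D, B x = 0 → fderiv ℝ B x (f x d) < 0) :
    ∀ T : ℝ, 0 ≤ T →
      ∀ (d : ℝ → EuclideanSpace ℝ (Fin m)) (x : ℝ → EuclideanSpace ℝ (Fin n)),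
        -- `d` is a continuous disturbance on `[0, T]` valued in `D`
        ContinuousOn d (Set.Icc 0 T) →
        (∀ t ∈ Set.Icc 0 T, d t ∈ D) →
        -- `x` is a solution of `ẋ(t) = f(x(t), d(t))` on `[0, T]`
        (∀ t ∈ Set.Icc 0 T, HasDerivAt x (f (x t) (d t)) t) →
        x 0 ∈ XI →
        (∀ t ∈ Set.Icc 0 T, x t ∈ X) →
        ∀ t ∈ Set.Icc 0 T, x t ∉ XU := by
  intro T _ d x _ hdD hx hx0 hxX t ht htU
  have hBx : ∀ s ∈ Set.Icc 0 T,
      HasDerivAt (fun s => B (x s)) (fderiv ℝ B (x s) (f (x s) (d s))) s := fun s hs =>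
    ((hB.differentiable one_ne_zero (x s)).hasFDerivAt).comp_hasDerivAt s (hx s hs)
  have hle : B (x t) ≤ 0 :=
    image_le_of_deriv_right_lt_deriv_boundary (f := fun s => B (x s))
      (B := fun _ => (0 : ℝ)) (B' := fun _ => 0)
      (fun s hs => (hBx s hs).continuousAt.continuousWithinAt)
      (fun s hs => (hBx s (Set.Ico_subset_Icc_self hs)).hasDerivWithinAt)
      (hBI _ hx0) (fun s => hasDerivAt_const s 0)
      (fun s hs h0 => hdec _ (hxX s (Set.Ico_subset_Icc_self hs)) _
        (hdD s (Set.Ico_subset_Icc_self hs)) h0) ht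
  exact (hBU _ htU).not_ge hle
end

section
/- Invariance of the zero sublevel set of a barrier certificate: Let f : ℝⁿ × ℝᵐ → ℝⁿ be continuous, X ⊆ ℝⁿ, D ⊆ ℝᵐ, and let B : ℝⁿ → ℝ be continuously differentiable with ⟪∇B(x), f(x,d)⟫ < 0 for all (x,d) ∈ X × D with B(x) = 0. Then the set {x ∈ X : B(x) ≤ 0} is invariant under the dynamics: for every T ≥ 0, every continuous disturbance d : [0,T] → D, and every solution x : [0,T] → ℝⁿ of ẋ(t) = f(x(t), d(t)) with B(x(0)) ≤ 0 and x(t) ∈ X for all t ∈ [0,T], one has B(x(t)) ≤ 0 for all t ∈ [0,T]. -/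
/-- **Invariance of the zero sublevel set of a barrier certificate.**
If the Lie derivative of `B` along the vector field is strictly negative on
`X × D` whenever `B x = 0`, then the set `{x ∈ X : B x ≤ 0}` is invariant:
every solution starting with `B (x 0) ≤ 0` and remaining in `X` satisfies
`B (x t) ≤ 0` for all times. -/
theorem zero_sublevel_set_invariant {n m : ℕ}
    (f : EuclideanSpace ℝ (Fin n) → EuclideanSpace ℝ (Fin m) → EuclideanSpace ℝ (Fin n))
    (hf : Continuous fun p : EuclideanSpace ℝ (Fin n) × EuclideanSpace ℝ (Fin m) => f p.1 p.2)
    (X : Set (EuclideanSpace ℝ (Fin n))) (D : Set (EuclideanSpace ℝ (Fin m)))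
    (B : EuclideanSpace ℝ (Fin n) → ℝ) (hB : ContDiff ℝ 1 B)
    (hdec : ∀ x ∈ X, ∀ d ∈ D, B x = 0 → fderiv ℝ B x (f x d) < 0) :
    ∀ T : ℝ, 0 ≤ T →
      ∀ (d : ℝ → EuclideanSpace ℝ (Fin m)) (x : ℝ → EuclideanSpace ℝ (Fin n)),
        -- `d` is a continuous disturbance on `[0, T]` valued in `D`
        ContinuousOn d (Set.Icc 0 T) →
        (∀ t ∈ Set.Icc 0 T, d t ∈ D) →
        -- `x` is a solution of `ẋ(t) = f(x(t), d(t))` on `[0, T]`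
        (∀ t ∈ Set.Icc 0 T, HasDerivAt x (f (x t) (d t)) t) →
        B (x 0) ≤ 0 →
        (∀ t ∈ Set.Icc 0 T, x t ∈ X) →
        ∀ t ∈ Set.Icc 0 T, B (x t) ≤ 0 := by
  intro T _ d x _ hdD hx h0 hxX
  have hderiv : ∀ t ∈ Set.Icc 0 T,
      HasDerivAt (fun s => B (x s)) (fderiv ℝ B (x t) (f (x t) (d t))) t := fun t ht =>
    ((hB.differentiable one_ne_zero) (x t)).hasFDerivAt.comp_hasDerivAt t (hx t ht)
  exact image_le_of_deriv_right_lt_deriv_boundary (B := fun _ => 0) (B' := fun _ => 0)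
    (fun t ht => (hderiv t ht).continuousAt.continuousWithinAt)
    (fun t ht => (hderiv t (Set.Ico_subset_Icc_self ht)).hasDerivWithinAt)
    h0 (fun t => hasDerivAt_const t 0)
    (fun t ht hBt => hdec (x t) (hxX t (Set.Ico_subset_Icc_self ht))
      (d t) (hdD t (Set.Ico_subset_Icc_self ht)) hBt)
end

section
/- Putinar's Positivstellensatz: Let g₁, …, g_m be real multivariate polynomials in n variables defining the semi-algebraic set K = {x ∈ ℝⁿ : g₁(x) ≥ 0, …, g_m(x) ≥ 0}, and assume the Archimedean condition: there exist N ∈ ℝ and sum-of-squares polynomials σ₀, σ₁, …, σ_m such that N − (x₁² + ⋯ + xₙ²) = σ₀ + σ₁·g₁ + ⋯ + σ_m·g_m. Then every real polynomial p with p(x) > 0 for all x ∈ K admits a Putinar representation: there exist sum-of-squares polynomials q₀, q₁, …, q_m with p = q₀ + q₁·g₁ + ⋯ + q_m·g_m. -/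
/-- A real multivariate polynomial is a sum of squares (SOS) if it can be written
as `p₁² + ⋯ + p_k²` for some polynomials `p₁, …, p_k`. -/
def IsSumOfSquares' {n : ℕ} (P : MvPolynomial (Fin n) ℝ) : Prop :=
  ∃ (k : ℕ) (p : Fin k → MvPolynomial (Fin n) ℝ), P = ∑ i, (p i) ^ 2

/-- A quadratic module in a commutative ring: a subset containing `1`, closed under
addition and under multiplication by squares. -/
structure IsQuadraticModule {A : Type*} [CommRing A] (M : Set A) : Prop where
  one_mem : 1 ∈ M
  add_mem : ∀ {a b}, a ∈ M → b ∈ M → a + b ∈ M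
  sq_mul_mem : ∀ (a) {b}, b ∈ M → a ^ 2 * b ∈ M

/-- A subset of a real algebra is Archimedean if every element is bounded above by a constant
with respect to it. -/
def IsArchimedeanModule {A : Type*} [CommRing A] [Algebra ℝ A] (M : Set A) : Prop :=
  ∀ f : A, ∃ N : ℝ, algebraMap ℝ A N - f ∈ M

/-- The elements of a real algebra that are infinitesimal with respect to `M`. -/
def infinitesimals {A : Type*} [CommRing A] [Algebra ℝ A] (M : Set A) : Set A :=
  {h | ∀ ε : ℝ, 0 < ε → algebraMap ℝ A ε + h ∈ M ∧ algebraMap ℝ A ε - h ∈ M}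

/-- The quadratic module generated by `M` and `f`. -/
def adjoinElement {A : Type*} [CommRing A] (M : Set A) (f : A) : Set A :=
  {a | ∃ m ∈ M, ∃ s, IsSumSq s ∧ a = m + f * s}

/-- The quadratic module generated by a finite family. -/
def putinarModule {A : Type*} [CommRing A] {m : ℕ} (g : Fin m → A) : Set A :=
  {a | ∃ (q₀ : A) (q : Fin m → A),
    IsSumSq q₀ ∧ (∀ i, IsSumSq (q i)) ∧ a = q₀ + ∑ i, q i * g i}

theorem IsSumSq.sq_mul {A : Type*} [CommRing A] {s : A} (hs : IsSumSq s) (a : A) :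
    IsSumSq (a ^ 2 * s) :=
  (pow_two a ▸ IsSumSq.mul_self a).mul hs

namespace IsQuadraticModule

section CommRing

variable {A : Type*} [CommRing A] {M : Set A}

theorem sq_mem (hM : IsQuadraticModule M) (a : A) : a ^ 2 ∈ M := by
  simpa using hM.sq_mul_mem a hM.one_mem

theorem zero_mem (hM : IsQuadraticModule M) : (0 : A) ∈ M := by
  simpa using hM.sq_mem 0

theorem isSumSq_mul_mem (hM : IsQuadraticModule M) {s b : A} (hs : IsSumSq s) (hb : b ∈ M) :
    s * b ∈ M := by
  induction hs with
  | zero => simpa using hM.zero_mem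
  | sq_add a _ ih =>
    rw [add_mul, ← pow_two]
    exact hM.add_mem (hM.sq_mul_mem a hb) ih

theorem isSumSq_mem (hM : IsQuadraticModule M) {s : A} (hs : IsSumSq s) : s ∈ M := by
  simpa using hM.isSumSq_mul_mem hs hM.one_mem

theorem sum_mem (hM : IsQuadraticModule M) {ι : Type*} (s : Finset ι) {f : ι → A}
    (hf : ∀ i ∈ s, f i ∈ M) : ∑ i ∈ s, f i ∈ M :=
  Finset.sum_induction f (· ∈ M) (fun _ _ => hM.add_mem) hM.zero_mem hf

theorem adjoin (hM : IsQuadraticModule M) (f : A) : IsQuadraticModule (adjoinElement M f) where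
  one_mem := ⟨1, hM.one_mem, 0, .zero, by simp⟩
  add_mem := by
    rintro _ _ ⟨a, ha, s, hs, rfl⟩ ⟨b, hb, t, ht, rfl⟩
    exact ⟨a + b, hM.add_mem ha hb, s + t, hs.add ht, by ring⟩
  sq_mul_mem := by
    rintro c _ ⟨a, ha, s, hs, rfl⟩
    exact ⟨c ^ 2 * a, hM.sq_mul_mem c ha, c ^ 2 * s, hs.sq_mul c, by ring⟩

theorem subset_adjoin (f : A) : M ⊆ adjoinElement M f :=
  fun a ha => ⟨a, ha, 0, .zero, by simp⟩

theorem self_mem_adjoin (hM : IsQuadraticModule M) (f : A) : f ∈ adjoinElement M f :=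
  ⟨0, hM.zero_mem, 1, by simp, by simp⟩

theorem putinar {m : ℕ} (g : Fin m → A) : IsQuadraticModule (putinarModule g) where
  one_mem := ⟨1, 0, by simp, fun _ => .zero, by simp⟩
  add_mem := by
    rintro _ _ ⟨a, q, ha, hq, rfl⟩ ⟨b, r, hb, hr, rfl⟩
    refine ⟨a + b, q + r, ha.add hb, fun i => (hq i).add (hr i), ?_⟩
    simp only [Pi.add_apply, add_mul, Finset.sum_add_distrib]
    ring
  sq_mul_mem := by
    rintro c _ ⟨a, q, ha, hq, rfl⟩
    refine ⟨c ^ 2 * a, fun i => c ^ 2 * q i, ha.sq_mul c, fun i => (hq i).sq_mul c, ?_⟩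
    simp only [mul_add, Finset.mul_sum, mul_assoc]

theorem generator_mem_putinarModule {m : ℕ} (g : Fin m → A) (i : Fin m) :
    g i ∈ putinarModule g := by
  classical
  refine ⟨0, Pi.single i 1, .zero, fun j => ?_, ?_⟩
  · by_cases h : j = i
    · subst h
      simp
    · simp [Pi.single_eq_of_ne h]
  · simp [Pi.single_apply]

/-- A proper quadratic module is contained in a maximal proper one. -/
theorem exists_le_maximal (hM : IsQuadraticModule M) (h : -1 ∉ M) :
    ∃ Q, M ⊆ Q ∧ Maximal (fun S : Set A => IsQuadraticModule S ∧ -1 ∉ S) Q := by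
  refine zorn_subset_nonempty {S : Set A | IsQuadraticModule S ∧ -1 ∉ S} ?_ M ⟨hM, h⟩
  intro c hc hchain ⟨T, hT⟩
  refine ⟨⋃₀ c, ⟨⟨⟨T, hT, (hc hT).1.one_mem⟩, ?_, ?_⟩, ?_⟩, fun s hs => Set.subset_sUnion_of_mem hs⟩
  · rintro a b ⟨S, hS, ha⟩ ⟨S', hS', hb⟩
    rcases hchain.total hS hS' with hle | hle
    · exact ⟨S', hS', (hc hS').1.add_mem (hle ha) hb⟩
    · exact ⟨S, hS, (hc hS).1.add_mem ha (hle hb)⟩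
  · rintro a b ⟨S, hS, hb⟩
    exact ⟨S, hS, (hc hS).1.sq_mul_mem a hb⟩
  · rintro ⟨S, hS, hneg⟩
    exact (hc hS).2 hneg

end CommRing

section Algebra

variable {A : Type*} [CommRing A] [Algebra ℝ A] {M : Set A}

theorem algebraMap_mul_mem (hM : IsQuadraticModule M) {c : ℝ} (hc : 0 ≤ c) {f : A}
    (hf : f ∈ M) : algebraMap ℝ A c * f ∈ M := by
  rw [← Real.sq_sqrt hc, map_pow]
  exact hM.sq_mul_mem _ hf

theorem algebraMap_mem (hM : IsQuadraticModule M) {c : ℝ} (hc : 0 ≤ c) :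
    algebraMap ℝ A c ∈ M := by
  simpa using hM.algebraMap_mul_mem hc hM.one_mem

theorem mem_of_algebraMap_mul_mem (hM : IsQuadraticModule M) {c : ℝ} (hc : 0 < c) {f : A}
    (hf : algebraMap ℝ A c * f ∈ M) : f ∈ M := by
  have := hM.algebraMap_mul_mem (inv_nonneg.2 hc.le) hf
  rwa [← mul_assoc, ← map_mul, inv_mul_cancel₀ hc.ne', map_one, one_mul] at this

theorem nonneg_of_algebraMap_mem (hM : IsQuadraticModule M) (h : -1 ∉ M) {c : ℝ}
    (hc : algebraMap ℝ A c ∈ M) : 0 ≤ c := by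
  by_contra! hneg
  refine h (hM.mem_of_algebraMap_mul_mem (neg_pos.2 hneg) ?_)
  simpa using hc

/-- The support of a quadratic module absorbs multiplication. -/
theorem mul_mem_of_neg_mem (hM : IsQuadraticModule M) {s : A} (hs : s ∈ M) (hs' : -s ∈ M)
    (a : A) : a * s ∈ M := by
  refine hM.mem_of_algebraMap_mul_mem (c := 4) (by norm_num) ?_
  have := hM.add_mem (hM.sq_mul_mem (a + 1) hs) (hM.sq_mul_mem (a - 1) hs')
  convert this using 1
  simp only [map_ofNat]
  ring

/-- If `c ± f` lie in a quadratic module, so does `c ^ 2 - f ^ 2`. -/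
theorem sq_sub_sq_mem (hM : IsQuadraticModule M) {c : ℝ} (hc : 0 < c) {f : A}
    (h₁ : algebraMap ℝ A c + f ∈ M) (h₂ : algebraMap ℝ A c - f ∈ M) :
    algebraMap ℝ A (c ^ 2) - f ^ 2 ∈ M := by
  refine hM.mem_of_algebraMap_mul_mem (c := 2 * c) (by positivity) ?_
  have := hM.add_mem (hM.sq_mul_mem (algebraMap ℝ A c + f) h₂)
    (hM.sq_mul_mem (algebraMap ℝ A c - f) h₁)
  convert this using 1
  simp only [map_mul, map_pow, map_ofNat]
  ring

theorem add_algebraMap_mem_of_le (hM : IsQuadraticModule M) {c d : ℝ} (h : c ≤ d) {f : A}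
    (hf : algebraMap ℝ A c + f ∈ M) : algebraMap ℝ A d + f ∈ M := by
  have := hM.add_mem (hM.algebraMap_mem (A := A) (sub_nonneg.2 h)) hf
  convert this using 1
  rw [map_sub]
  ring

theorem mem_or_neg_mem_of_maximal {Q : Set A}
    (hQ : Maximal (fun S : Set A => IsQuadraticModule S ∧ -1 ∉ S) Q) (f : A) :
    f ∈ Q ∨ -f ∈ Q := by
  obtain ⟨hQm, hQ1⟩ := hQ.prop
  have key : ∀ f ∉ Q, -1 ∈ adjoinElement Q f := by
    intro f hf
    by_contra hneg
    exact hf (hQ.le_of_ge ⟨hQm.adjoin f, hneg⟩ (subset_adjoin f) (hQm.self_mem_adjoin f))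
  by_contra! hf
  obtain ⟨q₁, hq₁, s₁, hs₁, e₁⟩ := key f hf.1
  obtain ⟨q₂, hq₂, s₂, hs₂, e₂⟩ := key (-f) hf.2
  have hneg : -s₁ ∈ Q := by
    have := hQm.add_mem (hQm.isSumSq_mem hs₂)
      (hQm.add_mem (hQm.isSumSq_mul_mem hs₂ hq₁) (hQm.isSumSq_mul_mem hs₁ hq₂))
    convert this using 1
    linear_combination s₁ * e₂ + s₂ * e₁
  exact hQ1 (e₁ ▸ hQm.add_mem hq₁ (hQm.mul_mem_of_neg_mem (hQm.isSumSq_mem hs₁) hneg f))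

theorem add_mem_infinitesimals (hM : IsQuadraticModule M) {f g : A}
    (hf : f ∈ infinitesimals M) (hg : g ∈ infinitesimals M) : f + g ∈ infinitesimals M := by
  intro ε hε
  have e : algebraMap ℝ A ε = algebraMap ℝ A (ε / 2) + algebraMap ℝ A (ε / 2) := by
    rw [← map_add, add_halves]
  obtain ⟨f₁, f₂⟩ := hf _ (half_pos hε)
  obtain ⟨g₁, g₂⟩ := hg _ (half_pos hε)
  constructor
  · convert hM.add_mem f₁ g₁ using 1
    rw [e]
    ring
  · convert hM.add_mem f₂ g₂ using 1
    rw [e]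
    ring

theorem neg_mem_infinitesimals {f : A} (hf : f ∈ infinitesimals M) :
    -f ∈ infinitesimals M := by
  intro ε hε
  simpa [sub_eq_add_neg] using (hf ε hε).symm

theorem algebraMap_mul_mem_infinitesimals (hM : IsQuadraticModule M) {f : A}
    (hf : f ∈ infinitesimals M) (c : ℝ) : algebraMap ℝ A c * f ∈ infinitesimals M := by
  have pos : ∀ d : ℝ, 0 < d → algebraMap ℝ A d * f ∈ infinitesimals M := by
    intro d hd ε hε
    obtain ⟨f₁, f₂⟩ := hf _ (div_pos hε hd)
    have e : algebraMap ℝ A ε = algebraMap ℝ A d * algebraMap ℝ A (ε / d) := by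
      rw [← map_mul, mul_div_cancel₀ _ hd.ne']
    rw [e, ← mul_add, ← mul_sub]
    exact ⟨hM.algebraMap_mul_mem hd.le f₁, hM.algebraMap_mul_mem hd.le f₂⟩
  rcases lt_trichotomy c 0 with hc | rfl | hc
  · simpa using neg_mem_infinitesimals (pos (-c) (neg_pos.2 hc))
  · intro ε hε
    simpa using hM.algebraMap_mem (A := A) hε.le
  · exact pos c hc

theorem sq_mem_infinitesimals (hM : IsQuadraticModule M) {f : A}
    (hf : f ∈ infinitesimals M) : f ^ 2 ∈ infinitesimals M := by
  intro ε hε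
  refine ⟨hM.add_mem (hM.algebraMap_mem hε.le) (hM.sq_mem f), ?_⟩
  obtain ⟨f₁, f₂⟩ := hf _ (Real.sqrt_pos.2 hε)
  simpa only [Real.sq_sqrt hε.le] using hM.sq_sub_sq_mem (Real.sqrt_pos.2 hε) f₁ f₂

theorem mul_mem_infinitesimals (hM : IsQuadraticModule M) {f g : A}
    (hf : f ∈ infinitesimals M) (hg : g ∈ infinitesimals M) : f * g ∈ infinitesimals M := by
  have h := hM.add_mem_infinitesimals
    (hM.sq_mem_infinitesimals (hM.add_mem_infinitesimals hf hg))
    (neg_mem_infinitesimals (hM.sq_mem_infinitesimals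
      (hM.add_mem_infinitesimals hf (neg_mem_infinitesimals hg))))
  have e : algebraMap ℝ A (1 / 4) * 4 = 1 := by
    rw [← map_ofNat (algebraMap ℝ A) 4, ← map_mul]
    norm_num
  convert hM.algebraMap_mul_mem_infinitesimals h (1 / 4) using 1
  linear_combination (-(f * g)) * e

/-- Modulo infinitesimals of a maximal proper Archimedean quadratic module, every element is
a constant. -/
theorem exists_sub_algebraMap_mem_infinitesimals {Q : Set A}
    (hQ : Maximal (fun S : Set A => IsQuadraticModule S ∧ -1 ∉ S) Q)
    (harch : IsArchimedeanModule Q) (f : A) :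
    ∃ r : ℝ, f - algebraMap ℝ A r ∈ infinitesimals Q := by
  obtain ⟨hQm, hQ1⟩ := hQ.prop
  set S : Set ℝ := {r | f - algebraMap ℝ A r ∈ Q} with hS
  have hne : S.Nonempty := by
    obtain ⟨N, hN⟩ := harch (-f)
    refine ⟨-N, ?_⟩
    simpa [hS, add_comm] using hN
  have hbdd : BddAbove S := by
    obtain ⟨N, hN⟩ := harch f
    refine ⟨N, fun r hr => ?_⟩
    have := hQm.add_mem hN hr
    rw [sub_add_sub_cancel, ← map_sub] at this
    exact sub_nonneg.1 (hQm.nonneg_of_algebraMap_mem hQ1 this)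
  refine ⟨sSup S, fun ε hε => ⟨?_, ?_⟩⟩
  · obtain ⟨r, hr, hlt⟩ := exists_lt_of_lt_csSup hne (sub_lt_self (sSup S) hε)
    have := hQm.add_mem (hQm.algebraMap_mem (A := A) (c := r - (sSup S - ε)) (by linarith)) hr
    convert this using 1
    simp only [map_sub]
    ring
  · have hnot : f - algebraMap ℝ A (sSup S + ε) ∉ Q := fun h =>
      absurd (le_csSup hbdd h) (by linarith)
    convert (mem_or_neg_mem_of_maximal hQ _).resolve_left hnot using 1
    rw [map_add]
    ring

/-- If `p * s - 1` lies in an Archimedean quadratic module for some sum of squares `s`, then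
so does `p`. -/
theorem mem_of_mul_sub_one_mem (hM : IsQuadraticModule M) (harch : IsArchimedeanModule M)
    {p s : A} (hs : IsSumSq s) (h : p * s - 1 ∈ M) : p ∈ M := by
  obtain ⟨k₁, hk₁⟩ := harch (s ^ 2 * p)
  obtain ⟨k₂, hk₂⟩ := harch s
  obtain ⟨k, hk₀, hk₁k, hk₂k⟩ : ∃ k : ℝ, 0 < k ∧ k₁ ≤ k ∧ k₂ ≤ 2 * k := by
    refine ⟨max 1 (max k₁ k₂), by positivity, by simp, ?_⟩
    have h₁ := le_max_left 1 (max k₁ k₂)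
    have h₂ := (le_max_right k₁ k₂).trans (le_max_right 1 (max k₁ k₂))
    linarith
  have hbound : algebraMap ℝ A k - s ^ 2 * p ∈ M := by
    rw [sub_eq_add_neg] at hk₁ ⊢
    exact hM.add_algebraMap_mem_of_le hk₁k hk₁
  have hbound' : algebraMap ℝ A (2 * k) - s ∈ M := by
    rw [sub_eq_add_neg] at hk₂ ⊢
    exact hM.add_algebraMap_mem_of_le hk₂k hk₂
  have hprod : s * (algebraMap ℝ A (2 * k) - s) ∈ M := by
    refine hM.mem_of_algebraMap_mul_mem (c := 2 * k) (by positivity) ?_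
    convert hM.add_mem (hM.sq_mul_mem s hbound')
      (hM.sq_mul_mem (algebraMap ℝ A (2 * k) - s) (hM.isSumSq_mem hs)) using 1
    ring
  have descend : ∀ r : ℝ, 0 ≤ r → algebraMap ℝ A r + p ∈ M →
      algebraMap ℝ A (r - 1 / k) + p ∈ M := by
    intro r hr hp
    refine hM.mem_of_algebraMap_mul_mem (c := k ^ 2) (by positivity) ?_
    convert hM.add_mem
      (hM.add_mem (hM.sq_mul_mem (algebraMap ℝ A k - s) hp)
        (hM.algebraMap_mul_mem (c := 2 * k) (by positivity) h))
      (hM.add_mem (hM.algebraMap_mul_mem hr hprod) hbound) using 1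
    have e : algebraMap ℝ A k * algebraMap ℝ A (1 / k) = 1 := by
      rw [← map_mul, mul_one_div_cancel hk₀.ne', map_one]
    simp only [map_sub, map_mul, map_pow, map_ofNat]
    linear_combination (-algebraMap ℝ A k) * e
  have main : ∀ (j : ℕ) (r : ℝ), r ≤ j / k → algebraMap ℝ A r + p ∈ M → p ∈ M := by
    have base : ∀ r : ℝ, r ≤ 0 → algebraMap ℝ A r + p ∈ M → p ∈ M := fun r hr hp => by
      simpa using hM.add_algebraMap_mem_of_le hr hp
    intro j
    induction j with
    | zero => simpa using base
    | succ j ih =>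
      intro r hr hp
      rcases le_total r 0 with h0 | h0
      · exact base r h0 hp
      · refine ih _ ?_ (descend r h0 hp)
        rw [Nat.cast_succ, add_div] at hr
        linarith
  obtain ⟨N, hN⟩ := harch (-p)
  obtain ⟨j, hj⟩ := exists_nat_ge (N * k)
  exact main j N ((le_div_iff₀ hk₀).2 hj) (by simpa using hN)

/-- Elements bounded in absolute value are closed under addition. -/
theorem exists_bound_add (hM : IsQuadraticModule M) {f g : A}
    (hf : ∃ N : ℝ, algebraMap ℝ A N + f ∈ M ∧ algebraMap ℝ A N - f ∈ M)
    (hg : ∃ N : ℝ, algebraMap ℝ A N + g ∈ M ∧ algebraMap ℝ A N - g ∈ M) :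
    ∃ N : ℝ, algebraMap ℝ A N + (f + g) ∈ M ∧ algebraMap ℝ A N - (f + g) ∈ M := by
  obtain ⟨a, f₁, f₂⟩ := hf
  obtain ⟨b, g₁, g₂⟩ := hg
  refine ⟨a + b, ?_, ?_⟩
  · convert hM.add_mem f₁ g₁ using 1
    rw [map_add]
    ring
  · convert hM.add_mem f₂ g₂ using 1
    rw [map_add]
    ring

/-- Squares of elements bounded in absolute value are bounded in absolute value. -/
theorem exists_bound_sq (hM : IsQuadraticModule M) {f : A}
    (hf : ∃ N : ℝ, algebraMap ℝ A N + f ∈ M ∧ algebraMap ℝ A N - f ∈ M) :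
    ∃ N : ℝ, algebraMap ℝ A N + f ^ 2 ∈ M ∧ algebraMap ℝ A N - f ^ 2 ∈ M := by
  obtain ⟨a, f₁, f₂⟩ := hf
  have hle : a ≤ max a 1 := le_max_left _ _
  refine ⟨max a 1 ^ 2, hM.add_mem (hM.algebraMap_mem (by positivity)) (hM.sq_mem f),
    hM.sq_sub_sq_mem (by positivity) (hM.add_algebraMap_mem_of_le hle f₁) ?_⟩
  rw [sub_eq_add_neg] at f₂ ⊢
  exact hM.add_algebraMap_mem_of_le hle f₂

/-- Products of elements bounded in absolute value are bounded in absolute value. -/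
theorem exists_bound_mul (hM : IsQuadraticModule M) {f g : A}
    (hf : ∃ N : ℝ, algebraMap ℝ A N + f ∈ M ∧ algebraMap ℝ A N - f ∈ M)
    (hg : ∃ N : ℝ, algebraMap ℝ A N + g ∈ M ∧ algebraMap ℝ A N - g ∈ M) :
    ∃ N : ℝ, algebraMap ℝ A N + f * g ∈ M ∧ algebraMap ℝ A N - f * g ∈ M := by
  have neg : ∀ {h : A}, (∃ N : ℝ, algebraMap ℝ A N + h ∈ M ∧ algebraMap ℝ A N - h ∈ M) →
      ∃ N : ℝ, algebraMap ℝ A N + -h ∈ M ∧ algebraMap ℝ A N - -h ∈ M := by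
    rintro h ⟨N, h₁, h₂⟩
    exact ⟨N, by simpa [sub_eq_add_neg] using h₂, by simpa using h₁⟩
  obtain ⟨N, h₁, h₂⟩ := hM.exists_bound_add (hM.exists_bound_sq (hM.exists_bound_add hf hg))
    (neg (hM.exists_bound_sq (hM.exists_bound_add hf (neg hg))))
  have e : algebraMap ℝ A N = 4 * algebraMap ℝ A (N / 4) := by
    rw [← map_ofNat (algebraMap ℝ A) 4, ← map_mul]
    congr 1
    ring
  refine ⟨N / 4, hM.mem_of_algebraMap_mul_mem (c := 4) (by norm_num) ?_,
    hM.mem_of_algebraMap_mul_mem (c := 4) (by norm_num) ?_⟩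
  · convert h₁ using 1
    rw [e, map_ofNat]
    ring
  · convert h₂ using 1
    rw [e, map_ofNat]
    ring

end Algebra

section MvPolynomial

open MvPolynomial

variable {n : ℕ} {M : Set (MvPolynomial (Fin n) ℝ)}

/-- A quadratic module of polynomials containing `N - ∑ xⱼ ^ 2` is Archimedean. -/
theorem isArchimedeanModule_of_sub_sum_sq_mem (hM : IsQuadraticModule M) {N : ℝ}
    (hN : C N - ∑ j : Fin n, X j ^ 2 ∈ M) : IsArchimedeanModule M := by
  have hX : ∀ j : Fin n, C N - X j ^ 2 ∈ M := by
    intro j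
    convert hM.add_mem hN (hM.sum_mem (Finset.univ.erase j) (f := fun i => X i ^ 2)
      (fun i _ => hM.sq_mem _)) using 1
    rw [← Finset.add_sum_erase _ _ (Finset.mem_univ j)]
    ring
  have hquarter : (C (1 / 4 : ℝ) : MvPolynomial (Fin n) ℝ) = C (1 / 2) ^ 2 := by
    rw [← C_pow]
    norm_num
  have htwo : (C (1 / 2 : ℝ) : MvPolynomial (Fin n) ℝ) * 2 = 1 := by
    rw [← map_ofNat C 2, ← C_mul]
    norm_num
  have bounded : ∀ f : MvPolynomial (Fin n) ℝ,
      ∃ N : ℝ, algebraMap ℝ (MvPolynomial (Fin n) ℝ) N + f ∈ M ∧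
        algebraMap ℝ (MvPolynomial (Fin n) ℝ) N - f ∈ M := by
    intro f
    have hC : ∀ a : ℝ, ∃ N : ℝ, algebraMap ℝ (MvPolynomial (Fin n) ℝ) N + C a ∈ M ∧
        algebraMap ℝ (MvPolynomial (Fin n) ℝ) N - C a ∈ M := by
      intro a
      refine ⟨|a|, ?_, ?_⟩
      · rw [← algebraMap_eq, ← map_add]
        exact hM.algebraMap_mem (by linarith [neg_abs_le a])
      · rw [← algebraMap_eq, ← map_sub]
        exact hM.algebraMap_mem (by linarith [le_abs_self a])
    induction f using MvPolynomial.induction_on with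
    | C a => exact hC a
    | add p q hp hq => exact hM.exists_bound_add hp hq
    | mul_X p j hp =>
      refine hM.exists_bound_mul hp ⟨N + 1 / 4, ?_, ?_⟩
      · convert hM.add_mem (hX j) (hM.sq_mem (X j + C (1 / 2))) using 1
        rw [algebraMap_eq, C_add, hquarter]
        linear_combination (-X j) * htwo
      · convert hM.add_mem (hX j) (hM.sq_mem (X j - C (1 / 2))) using 1
        rw [algebraMap_eq, C_add, hquarter]
        linear_combination X j * htwo
  exact fun f => (bounded f).imp fun _ h => h.2

/-- A proper Archimedean quadratic module of polynomials has a point at which all its elements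
are nonnegative. -/
theorem exists_eval_nonneg (hM : IsQuadraticModule M) (harch : IsArchimedeanModule M)
    (h : -1 ∉ M) : ∃ x : Fin n → ℝ, ∀ f ∈ M, 0 ≤ eval x f := by
  obtain ⟨Q, hMQ, hQ⟩ := hM.exists_le_maximal h
  obtain ⟨hQm, hQ1⟩ := hQ.prop
  have harchQ : IsArchimedeanModule Q := fun f => (harch f).imp fun _ hf => hMQ hf
  choose x hx using fun j : Fin n => exists_sub_algebraMap_mem_infinitesimals hQ harchQ (X j)
  have hev : ∀ f : MvPolynomial (Fin n) ℝ, f - C (eval x f) ∈ infinitesimals Q := by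
    intro f
    induction f using MvPolynomial.induction_on with
    | C a =>
      intro ε hε
      simpa using hQm.algebraMap_mem (A := MvPolynomial (Fin n) ℝ) hε.le
    | add p q hp hq =>
      convert hQm.add_mem_infinitesimals hp hq using 1
      rw [map_add, C_add]
      ring
    | mul_X p j hp =>
      convert hQm.add_mem_infinitesimals (hQm.mul_mem_infinitesimals hp (hx j))
        (hQm.add_mem_infinitesimals
          (hQm.algebraMap_mul_mem_infinitesimals hp (x j))
          (hQm.algebraMap_mul_mem_infinitesimals (hx j) (eval x p))) using 1
      simp only [map_mul, eval_X, algebraMap_eq]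
      ring
  refine ⟨x, fun f hf => le_of_forall_pos_le_add fun ε hε => ?_⟩
  refine hQm.nonneg_of_algebraMap_mem (A := MvPolynomial (Fin n) ℝ) hQ1 ?_
  convert hQm.add_mem (hev f ε hε).2 (hMQ hf) using 1
  rw [map_add, algebraMap_eq]
  ring

/-- A polynomial positive wherever an Archimedean quadratic module is nonnegative belongs to
that module. -/
theorem mem_of_eval_pos (hM : IsQuadraticModule M) (harch : IsArchimedeanModule M)
    {p : MvPolynomial (Fin n) ℝ}
    (hpos : ∀ x : Fin n → ℝ, (∀ f ∈ M, 0 ≤ eval x f) → 0 < eval x p) : p ∈ M := by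
  have hneg : -1 ∈ adjoinElement M (-p) := by
    by_contra hneg
    obtain ⟨x, hx⟩ := (hM.adjoin (-p)).exists_eval_nonneg
      (fun f => (harch f).imp fun _ hf => subset_adjoin _ hf) hneg
    have h₁ := hpos x fun f hf => hx f (subset_adjoin _ hf)
    have h₂ := hx _ (hM.self_mem_adjoin (-p))
    rw [map_neg] at h₂
    linarith
  obtain ⟨q, hq, s, hs, e⟩ := hneg
  refine hM.mem_of_mul_sub_one_mem harch hs ?_
  convert hq using 1
  linear_combination e

end MvPolynomial

end IsQuadraticModule

theorem isSumOfSquares'_iff_isSumSq {n : ℕ} {P : MvPolynomial (Fin n) ℝ} :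
    IsSumOfSquares' P ↔ IsSumSq P := by
  constructor
  · rintro ⟨k, p, rfl⟩
    exact IsSumSq.sum fun i _ => by simpa only [pow_two] using IsSumSq.mul_self (p i)
  · intro h
    induction h with
    | zero => exact ⟨0, Fin.elim0, by simp⟩
    | sq_add a _ ih =>
      obtain ⟨k, p, rfl⟩ := ih
      exact ⟨k + 1, Fin.cons a p, by simp [Fin.sum_univ_succ, pow_two]⟩

/-- **Putinar's Positivstellensatz.**
If the quadratic module generated by `g₁, …, g_m` is Archimedean (i.e. `N − Σⱼ xⱼ²`
has a Putinar representation for some `N ∈ ℝ`), then every polynomial `p` that is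
strictly positive on `K = {x : g₁(x) ≥ 0, …, g_m(x) ≥ 0}` admits a Putinar
representation `p = q₀ + q₁·g₁ + ⋯ + q_m·g_m` with all `qᵢ` sums of squares. -/
theorem putinar_positivstellensatz {n m : ℕ}
    (g : Fin m → MvPolynomial (Fin n) ℝ)
    -- Archimedean condition
    (harch : ∃ (N : ℝ) (σ₀ : MvPolynomial (Fin n) ℝ) (σ : Fin m → MvPolynomial (Fin n) ℝ),
      IsSumOfSquares' σ₀ ∧ (∀ i, IsSumOfSquares' (σ i)) ∧
      MvPolynomial.C N - ∑ j : Fin n, (MvPolynomial.X j) ^ 2 = σ₀ + ∑ i, σ i * g i)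
    (p : MvPolynomial (Fin n) ℝ)
    -- `p` is strictly positive on `K`
    (hpos : ∀ x : Fin n → ℝ, (∀ i, 0 ≤ MvPolynomial.eval x (g i)) →
      0 < MvPolynomial.eval x p) :
    ∃ (q₀ : MvPolynomial (Fin n) ℝ) (q : Fin m → MvPolynomial (Fin n) ℝ),
      IsSumOfSquares' q₀ ∧ (∀ i, IsSumOfSquares' (q i)) ∧
      p = q₀ + ∑ i, q i * g i := by
  simp only [isSumOfSquares'_iff_isSumSq] at harch ⊢
  obtain ⟨N, σ₀, σ, hσ₀, hσ, e⟩ := harch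
  have hM := IsQuadraticModule.putinar g
  exact hM.mem_of_eval_pos (hM.isArchimedeanModule_of_sub_sum_sq_mem ⟨σ₀, σ, hσ₀, hσ, e⟩)
    fun x hx => hpos x fun i => hx _ (IsQuadraticModule.generator_mem_putinarModule g i)
end

section
/- Safety of the illustrative nonlinear system: Consider the planar system ẋ₁ = x₂, ẋ₂ = −x₁ + (1/3)x₁³ − x₂, with initial set X_I = {x ∈ ℝ² : (x₁ − 1.5)² + x₂² ≤ 0.25} and unsafe set X_U = {x ∈ ℝ² : (x₁ + 1)² + (x₂ + 1)² ≤ 0.16}. Then the system is safe: for every T ≥ 0 and every solution x : [0,T] → ℝ² of this system with x(0) ∈ X_I, one has x(t) ∉ X_U for all t ∈ [0,T]. -/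
/-- A barrier certificate for the system `ẋ₁ = x₂`, `ẋ₂ = −x₁ + (1/3)x₁³ − x₂`. -/
noncomputable def barrier (a b : ℝ) : ℝ :=
  b ^ 2 + (a - a ^ 3 / 3) * b + (7 / 10) * a ^ 2 - (7 / 60) * a ^ 4 - (2 / 5) * a ^ 3
    + (2 / 25) * a ^ 5

/-- Along a solution the derivative of the barrier is minus a sum of two squares. -/
theorem hasDerivAt_barrier {x : ℝ → ℝ × ℝ} {t : ℝ}
    (h : HasDerivAt x ((x t).2, -(x t).1 + (1 / 3) * (x t).1 ^ 3 - (x t).2) t) :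
    HasDerivAt (fun s => barrier (x s).1 (x s).2)
      (-(((4 / 5 + 3 / 5 * (x t).1) * (x t).2 + ((x t).1 - (x t).1 ^ 3 / 3)) ^ 2
        + ((3 / 5 - 4 / 5 * (x t).1) * (x t).2) ^ 2)) t := by
  have h₁ : HasDerivAt (fun s => (x s).1) (x t).2 t := by
    simpa using h.hasFDerivAt.fst.hasDerivAt
  have h₂ : HasDerivAt (fun s => (x s).2) (-(x t).1 + (1 / 3) * (x t).1 ^ 3 - (x t).2) t := by
    simpa using h.hasFDerivAt.snd.hasDerivAt
  refine HasDerivAt.congr_deriv ((((((h₂.pow 2).add ((h₁.sub ((h₁.pow 3).div_const 3)).mul h₂)).add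
    ((h₁.pow 2).const_mul (7 / 10))).sub ((h₁.pow 4).const_mul (7 / 60))).sub
    ((h₁.pow 3).const_mul (2 / 5))).add ((h₁.pow 5).const_mul (2 / 25))) ?_
  simp only [Pi.sub_apply, Pi.pow_apply]
  push_cast
  ring

theorem barrier_lt_of_mem_initial {a b : ℝ} (h : (a - 1.5) ^ 2 + b ^ 2 ≤ 0.25) :
    barrier a b < 9 / 10 := by
  norm_num at h
  have ha₁ : 1 ≤ a := by nlinarith [sq_nonneg b]
  have ha₂ : a ≤ 2 := by nlinarith [sq_nonneg b]
  have hcross : (a - a ^ 3 / 3) * b ≤ ((a - a ^ 3 / 3) ^ 2 + b ^ 2) / 2 := by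
    nlinarith [sq_nonneg (a - a ^ 3 / 3 - b)]
  have hpoly : 3 / 2 * (1 / 4 - (a - 3 / 2) ^ 2) + (a - a ^ 3 / 3) ^ 2 / 2 + (7 / 10) * a ^ 2
      - (7 / 60) * a ^ 4 - (2 / 5) * a ^ 3 + (2 / 25) * a ^ 5 < 9 / 10 := by
    obtain ⟨u, rfl⟩ : ∃ u, a = u + 1 := ⟨a - 1, by ring⟩
    have hu : 0 ≤ u := by linarith
    have hv : 0 ≤ 1 - u := by linarith
    nlinarith [mul_nonneg hu hv, mul_nonneg (mul_nonneg hu hv) (sq_nonneg u),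
      mul_nonneg (mul_nonneg hu hv) (sq_nonneg (u ^ 2)), mul_nonneg (mul_nonneg hu hv) hu,
      mul_nonneg (mul_nonneg hu hv) (pow_nonneg hu 3), sq_nonneg (u - 1 / 2),
      sq_nonneg (u * (u - 1 / 2)), sq_nonneg (u ^ 2 * (u - 1 / 2))]
  unfold barrier
  linarith

theorem lt_barrier_of_mem_forbidden {a b : ℝ} (h : (a + 1) ^ 2 + (b + 1) ^ 2 ≤ 0.16) :
    9 / 10 < barrier a b := by
  norm_num at h
  have ha₁ : -(7 / 5) ≤ a := by nlinarith [sq_nonneg (b + 1)]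
  have ha₂ : a ≤ -(3 / 5) := by nlinarith [sq_nonneg (b + 1)]
  have hb : b ≤ -(3 / 5) := by nlinarith [sq_nonneg (a + 1)]
  obtain ⟨u, rfl⟩ : ∃ u, a = -u := ⟨-a, by ring⟩
  have hu : 0 ≤ u - 3 / 5 := by linarith
  have hv : 0 ≤ 7 / 5 - u := by linarith
  have huv := mul_nonneg hu hv
  have hslope : 48 / 100 ≤ u - u ^ 3 / 3 := by nlinarith [mul_nonneg huv hu]
  have hpot : 3 / 10 ≤ (7 / 10) * u ^ 2 - (7 / 60) * u ^ 4 + (2 / 5) * u ^ 3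
      - (2 / 25) * u ^ 5 := by
    nlinarith [mul_nonneg huv hu, mul_nonneg huv (sq_nonneg u), mul_nonneg (mul_nonneg huv hu)
      (sq_nonneg u), mul_nonneg huv (sq_nonneg (u - 1))]
  unfold barrier
  nlinarith [mul_nonneg (sub_nonneg.2 hslope) (by linarith : 0 ≤ -b - 3 / 5)]

/-- **Safety of the illustrative nonlinear system.**
For the planar system `ẋ₁ = x₂`, `ẋ₂ = −x₁ + (1/3)x₁³ − x₂` with initial set
`X_I = {x : (x₁ − 1.5)² + x₂² ≤ 0.25}` and unsafe set
`X_U = {x : (x₁ + 1)² + (x₂ + 1)² ≤ 0.16}`, every solution starting in `X_I`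
avoids `X_U` for all time. -/
theorem illustrative_planar_system_safe :
    ∀ T : ℝ, 0 ≤ T →
      ∀ x : ℝ → ℝ × ℝ,
        -- `x` is a solution of the planar system on `[0, T]`
        (∀ t ∈ Set.Icc 0 T,
          HasDerivAt x ((x t).2, -(x t).1 + (1 / 3) * (x t).1 ^ 3 - (x t).2) t) →
        -- starting in the initial set `X_I`
        ((x 0).1 - 1.5) ^ 2 + (x 0).2 ^ 2 ≤ 0.25 →
        -- never enters the unsafe set `X_U`
        ∀ t ∈ Set.Icc 0 T, ¬(((x t).1 + 1) ^ 2 + ((x t).2 + 1) ^ 2 ≤ 0.16) := by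
  intro T _ x hx h0 t ht hU
  have hanti : AntitoneOn (fun s => barrier (x s).1 (x s).2) (Set.Icc 0 T) := by
    refine antitoneOn_of_deriv_nonpos (convex_Icc 0 T)
      (fun s hs => (hasDerivAt_barrier (hx s hs)).continuousAt.continuousWithinAt)
      (fun s hs => (hasDerivAt_barrier
        (hx s (interior_subset hs))).differentiableAt.differentiableWithinAt)
      (fun s hs => ?_)
    rw [(hasDerivAt_barrier (hx s (interior_subset hs))).deriv]
    exact neg_nonpos.2 (by positivity)
  have hle := hanti (Set.left_mem_Icc.2 (ht.1.trans ht.2)) ht ht.1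
  have hI := barrier_lt_of_mem_initial h0
  have hlt := lt_barrier_of_mem_forbidden hU
  simp only at hle
  linarith
end
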